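/- arXiv:2601.20513 — 3 statements merged into one kernel-verified Lean document; each statement's English description precedes it below -/
import Mathlib

section
/- Let N ≥ 3 be an integer, let a, b be reals with 0 < a < (N−2)/2 and a < b < a+1, set d := 1+a−b, 2♯ := 2N/(N−2d), q_c := (4+2N)/(N−2a+2b), δ_{q_c} := 2/q_c. Let ρ > 0 and 0 < β < q_c/(2 C_{a,b}^{q_c} ρ^{4d/(N−2a+2b)}). Then for every radial u ∈ C_c^∞(ℝ^N), u ≠ 0, with ∫|x|^{−2a}|u|² dx = ρ²: (a) (1/2)A(u) − (β/q_c)B_{q_c}(u) ≥ (1/2 − (β/q_c)C_{a,b}^{q_c}ρ^{4d/(N−2a+2b)})A(u) > 0; (b) the fiber map Φ^u_β(t) := ((1/2)A(u) − (β/q_c)B_{q_c}(u))e^{2t} − (e^{2♯ t}/2♯)B_{2♯}(u) has a unique critical point t_* ∈ ℝ, which is its strict global maximum, and Φ^u_β(t_*) > 0; (c) Φ^u_β is concave and strictly decreasing on (t_*, ∞); (d) Φ^u_β′(0) < 0 if and only if t_* < 0. -/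
open MeasureTheory Real Set Filter Asymptotics

noncomputable section

abbrev E (N : ℕ) := EuclideanSpace ℝ (Fin N)

/-- Weighted gradient integral `∫ |x|^{-2a} |∇u|²`. -/
def Aint (N : ℕ) (a : ℝ) (u : E N → ℝ) : ℝ :=
  ∫ x : E N, ‖x‖ ^ (-(2 * a)) * ‖fderiv ℝ u x‖ ^ 2

/-- Weighted mass `∫ |x|^{-2a} |u|²`. -/
def mint (N : ℕ) (a : ℝ) (u : E N → ℝ) : ℝ :=
  ∫ x : E N, ‖x‖ ^ (-(2 * a)) * (u x) ^ 2

/-- Weighted `L^s` integral `∫ |x|^{-bs} |u|^s`. -/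
def Bint (N : ℕ) (b s : ℝ) (u : E N → ℝ) : ℝ :=
  ∫ x : E N, ‖x‖ ^ (-(b * s)) * |u x| ^ s

/-- A function on `ℝ^N` is radial if it depends only on the norm. -/
def IsRadial {N : ℕ} (u : E N → ℝ) : Prop :=
  ∀ x y : E N, ‖x‖ = ‖y‖ → u x = u y

/-- The best Caffarelli–Kohn–Nirenberg constant `S(a,b)` (with critical exponent `p = 2♯`). -/
def Sab (N : ℕ) (a b p : ℝ) : ℝ :=
  sInf {r : ℝ | ∃ u : E N → ℝ, ContDiff ℝ (⊤ : ℕ∞) u ∧ HasCompactSupport u ∧ u ≠ 0 ∧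
    r = Aint N a u / (Bint N b p u) ^ (2 / p)}

/-- A power weight integrable at the origin, integrated against a nonnegative continuous function
with compact support which is not identically zero, gives a positive number. -/
lemma integral_norm_rpow_mul_pos {N : ℕ} (hN : 1 ≤ N) {s : ℝ} (hs : s < N) {g : E N → ℝ}
    (hg : Continuous g) (hgc : HasCompactSupport g) (hg0 : ∀ x, 0 ≤ g x) (hne : ∃ x, g x ≠ 0) :
    0 < ∫ x : E N, ‖x‖ ^ (-s) * g x := by
  have : Nontrivial (E N) :=
    Module.nontrivial_of_finrank_pos (R := ℝ) (by rw [finrank_euclideanSpace_fin]; omega)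
  have hloc : LocallyIntegrable (fun x : E N ↦ ‖x‖ ^ (-s)) := by
    refine locallyIntegrable_of_norm_le_rpow (C := 1) (α := s) ?_ ?_ ?_ ?_
    · rwa [finrank_euclideanSpace_fin]
    · rwa [finrank_euclideanSpace_fin]
    · refine Eventually.of_forall fun x ↦ ?_
      rw [one_mul, Real.norm_of_nonneg (Real.rpow_nonneg (norm_nonneg x) _)]
    · exact (measurable_norm.pow_const _).aestronglyMeasurable
  have hint : Integrable (fun x : E N ↦ ‖x‖ ^ (-s) * g x) :=
    hloc.integrable_smul_right_of_hasCompactSupport hg hgc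
  rw [integral_pos_iff_support_of_nonneg
    (fun x ↦ mul_nonneg (Real.rpow_nonneg (norm_nonneg x) _) (hg0 x)) hint]
  have hsub : Function.support g \ {0} ⊆ Function.support fun x : E N ↦ ‖x‖ ^ (-s) * g x := by
    rintro x ⟨hx, hx0⟩
    exact mul_ne_zero (Real.rpow_pos_of_pos (norm_pos_iff.2 hx0) _).ne' hx
  refine lt_of_lt_of_le ?_ (measure_mono hsub)
  rw [measure_sdiff_null (measure_singleton 0)]
  exact hg.isOpen_support.measure_pos volume hne

lemma Aint_pos {N : ℕ} (hN : 1 ≤ N) {a : ℝ} (ha : 2 * a < N) {u : E N → ℝ}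
    (hu : ContDiff ℝ (⊤ : ℕ∞) u) (huc : HasCompactSupport u) (hne : u ≠ 0) : 0 < Aint N a u := by
  have : Nontrivial (E N) :=
    Module.nontrivial_of_finrank_pos (R := ℝ) (by rw [finrank_euclideanSpace_fin]; omega)
  have hcont : Continuous (fderiv ℝ u) := hu.continuous_fderiv (by simp)
  refine integral_norm_rpow_mul_pos hN ha (hcont.norm.pow 2)
    ((huc.fderiv (𝕜 := ℝ)).comp_left (g := fun L ↦ ‖L‖ ^ 2) (by simp))
    (fun x ↦ by positivity) ?_
  by_contra! h
  have hconst := is_const_of_fderiv_eq_zero (𝕜 := ℝ) (hu.differentiable (by simp))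
    fun x ↦ by simpa using h x
  obtain ⟨y, hy⟩ : ∃ y, u y = 0 := by
    by_contra! hy
    refine noncompact_univ (E N) ?_
    have : Function.support u = univ := eq_univ_of_forall hy
    simpa [HasCompactSupport, tsupport, this] using huc
  exact hne (funext fun x ↦ (hconst x y).trans hy)

lemma Bint_pos {N : ℕ} (hN : 1 ≤ N) {b s : ℝ} (hs : 0 < s) (hbs : b * s < N) {u : E N → ℝ}
    (hu : Continuous u) (huc : HasCompactSupport u) (hne : u ≠ 0) : 0 < Bint N b s u := by
  obtain ⟨x, hx⟩ := Function.ne_iff.1 hne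
  exact integral_norm_rpow_mul_pos hN hbs (hu.abs.rpow_const fun _ ↦ Or.inr hs.le)
    (huc.comp_left (g := fun y ↦ |y| ^ s) (by simp [hs.ne']))
    (fun x ↦ Real.rpow_nonneg (abs_nonneg _) _)
    ⟨x, (Real.rpow_pos_of_pos (abs_pos.2 hx) _).ne'⟩

lemma Bint_nonneg (N : ℕ) (b s : ℝ) (u : E N → ℝ) : 0 ≤ Bint N b s u :=
  integral_nonneg fun x ↦
    mul_nonneg (Real.rpow_nonneg (norm_nonneg x) _) (Real.rpow_nonneg (abs_nonneg _) _)

/-- The derivative of `t ↦ K e^{2t} - D e^{pt} / p` in factored form, when the coefficient `K` is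
written as `D e^{(p-2)τ} / 2`. -/
lemma hasDerivAt_fiber {D p τ : ℝ} (hp : 2 < p) {Φ : ℝ → ℝ}
    (hΦ : ∀ t, Φ t = D * exp ((p - 2) * τ) / 2 * exp (2 * t) - exp (p * t) / p * D) (t : ℝ) :
    HasDerivAt Φ (-(D * exp (2 * t) * (exp ((p - 2) * t) - exp ((p - 2) * τ)))) t := by
  have h2 : HasDerivAt (fun t : ℝ ↦ exp (2 * t)) (exp (2 * t) * (2 * 1)) t :=
    ((hasDerivAt_id t).const_mul 2).exp
  have hpt : HasDerivAt (fun t : ℝ ↦ exp (p * t)) (exp (p * t) * (p * 1)) t :=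
    ((hasDerivAt_id t).const_mul p).exp
  have h := (h2.const_mul (D * exp ((p - 2) * τ) / 2)).sub ((hpt.div_const p).mul_const D)
  rw [funext hΦ]
  refine h.congr_deriv ?_
  have hexp : exp (p * t) = exp (2 * t) * exp ((p - 2) * t) := by rw [← exp_add]; ring_nf
  have hp0 : p ≠ 0 := by linarith
  rw [hexp]
  field_simp
  ring

/-- Geometry of `t ↦ K e^{2t} - D e^{pt} / p` for `K, D > 0` and `p > 2`. -/
lemma fiber_geometry {K D p : ℝ} (hK : 0 < K) (hD : 0 < D) (hp : 2 < p) {Φ : ℝ → ℝ}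
    (hΦ : ∀ t, Φ t = K * exp (2 * t) - exp (p * t) / p * D) :
    ∃ τ : ℝ, deriv Φ τ = 0 ∧ (∀ t, deriv Φ t = 0 → t = τ) ∧ (∀ t, t ≠ τ → Φ t < Φ τ) ∧
      0 < Φ τ ∧ ConcaveOn ℝ (Ioi τ) Φ ∧ StrictAntiOn Φ (Ioi τ) ∧ (deriv Φ 0 < 0 ↔ τ < 0) := by
  have hp2 : 0 < p - 2 := by linarith
  obtain ⟨τ, hτ⟩ : ∃ τ, K = D * exp ((p - 2) * τ) / 2 := by
    refine ⟨log (2 * K / D) / (p - 2), ?_⟩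
    rw [mul_div_cancel₀ _ hp2.ne', exp_log (by positivity)]
    field_simp
  subst hτ
  have hderiv t := (hasDerivAt_fiber hp hΦ t).deriv
  have hdiff : Differentiable ℝ Φ := fun t ↦ (hasDerivAt_fiber hp hΦ t).differentiableAt
  have hexp {s t : ℝ} : exp ((p - 2) * s) < exp ((p - 2) * t) ↔ s < t := by
    rw [exp_lt_exp, mul_lt_mul_iff_right₀ hp2]
  have hneg {t : ℝ} : deriv Φ t < 0 ↔ τ < t := by
    rw [hderiv, neg_lt_zero, mul_pos_iff_of_pos_left (by positivity), sub_pos, hexp]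
  have hpos {t : ℝ} : 0 < deriv Φ t ↔ t < τ := by
    rw [hderiv, ← mul_neg, mul_pos_iff_of_pos_left (by positivity), neg_sub, sub_pos, hexp]
  have hanti : StrictAntiOn Φ (Ici τ) := strictAntiOn_of_deriv_neg (convex_Ici τ)
    hdiff.continuous.continuousOn fun t ht ↦ hneg.2 (by simpa using ht)
  have hmono : StrictMonoOn Φ (Iic τ) := strictMonoOn_of_deriv_pos (convex_Iic τ)
    hdiff.continuous.continuousOn fun t ht ↦ hpos.2 (by simpa using ht)
  refine ⟨τ, by simp [hderiv], fun t ht ↦ ?_, fun t ht ↦ ?_, ?_, ?_,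
    hanti.mono Ioi_subset_Ici_self, hneg⟩
  · exact le_antisymm (not_lt.1 fun h ↦ (hneg.2 h).ne ht) (not_lt.1 fun h ↦ (hpos.2 h).ne' ht)
  · rcases ht.lt_or_gt with h | h
    · exact hmono h.le self_mem_Iic h
    · exact hanti self_mem_Ici h.le h
  · have h : Φ τ = D * exp (p * τ) * ((p - 2) / (2 * p)) := by
      have : exp (p * τ) = exp ((p - 2) * τ) * exp (2 * τ) := by rw [← exp_add]; ring_nf
      rw [hΦ, this]
      field_simp
    rw [h]
    positivity
  · refine AntitoneOn.concaveOn_of_deriv (convex_Ioi τ) hdiff.continuous.continuousOn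
      hdiff.differentiableOn ?_
    rw [interior_Ioi]
    intro s hs t _ hst
    have hs' : exp ((p - 2) * τ) ≤ exp ((p - 2) * s) := (hexp.2 hs).le
    rw [hderiv, hderiv, neg_le_neg_iff]
    have := sub_nonneg.2 hs'
    gcongr

/-- Raising the interpolation inequality at the mass-critical exponent to the power `q`. -/
lemma le_of_rpow_interpolation {A B C q ρ : ℝ} (hA : 0 ≤ A) (hB : 0 ≤ B) (hC : 0 ≤ C)
    (hρ : 0 < ρ) (hq : 0 < q)
    (h : B ^ (1 / q) ≤ C * A ^ ((2 / q) / 2) * (ρ ^ 2) ^ ((1 - 2 / q) / 2)) :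
    B ≤ C ^ q * ρ ^ (q - 2) * A := by
  have h' := Real.rpow_le_rpow (by positivity) h hq.le
  rw [Real.mul_rpow (by positivity) (by positivity), Real.mul_rpow hC (by positivity),
    ← Real.rpow_mul hB, ← Real.rpow_mul hA, ← Real.rpow_natCast ρ 2, ← Real.rpow_mul hρ.le,
    ← Real.rpow_mul hρ.le] at h'
  have e1 : 1 / q * q = 1 := by field_simp
  have e2 : 2 / q / 2 * q = 1 := by field_simp
  have e3 : ((2 : ℕ) : ℝ) * ((1 - 2 / q) / 2) * q = q - 2 := by push_cast; field_simp
  rw [e1, e2, e3, Real.rpow_one, Real.rpow_one] at h'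
  linarith

/-- Lemma 5.2 (mass-critical fiber-map geometry): for `q = q_c`, `ρ > 0` and
`0 < β < q_c/(2 C_{a,b}^{q_c} ρ^{4d/(N-2a+2b)})`, and any nonzero radial test function `u`
of mass `ρ²`: (a) the coefficient `(1/2)A(u) - (β/q_c)B_{q_c}(u)` is bounded below by
`(1/2 - (β/q_c)C^{q_c}ρ^{4d/(N-2a+2b)})A(u) > 0`; (b) the fiber map has a unique critical
point `t_*`, a strict global maximum at a positive level; (c) it is concave and strictly
decreasing on `(t_*, ∞)`; (d) `Φ'(0) < 0` iff `t_* < 0`. -/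
theorem masscritical_fiber_geometry (N : ℕ) (hN : 3 ≤ N) (a b d p qc ρ β Cab : ℝ)
    (ha : 0 < a) (ha' : a < ((N : ℝ) - 2) / 2) (hab : a < b) (hb : b < a + 1)
    (hd : d = 1 + a - b) (hp : p = 2 * N / ((N : ℝ) - 2 * d))
    (hqc : qc = (4 + 2 * N) / ((N : ℝ) - 2 * a + 2 * b))
    (hρ : 0 < ρ)
    (hCab : IsLeast {C : ℝ | 0 < C ∧ ∀ u : E N → ℝ,
      ContDiff ℝ (⊤ : ℕ∞) u → HasCompactSupport u →
        (Bint N b qc u) ^ (1 / qc) ≤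
          C * (Aint N a u) ^ ((2 / qc) / 2) * (mint N a u) ^ ((1 - 2 / qc) / 2)} Cab)
    (hβ : 0 < β)
    (hβ' : β < qc / (2 * Cab ^ qc * ρ ^ (4 * d / ((N : ℝ) - 2 * a + 2 * b)))) :
    ∀ u : E N → ℝ, ContDiff ℝ (⊤ : ℕ∞) u → HasCompactSupport u → IsRadial u → u ≠ 0 →
      mint N a u = ρ ^ 2 →
      ((1 / 2) * Aint N a u - (β / qc) * Bint N b qc u ≥
        (1 / 2 - (β / qc) * Cab ^ qc * ρ ^ (4 * d / ((N : ℝ) - 2 * a + 2 * b))) * Aint N a u ∧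
       0 < (1 / 2 - (β / qc) * Cab ^ qc * ρ ^ (4 * d / ((N : ℝ) - 2 * a + 2 * b))) * Aint N a u) ∧
      ∀ Φ : ℝ → ℝ, (∀ t : ℝ, Φ t =
          ((1 / 2) * Aint N a u - (β / qc) * Bint N b qc u) * Real.exp (2 * t)
          - Real.exp (p * t) / p * Bint N b p u) →
        ∃ tstar : ℝ,
          deriv Φ tstar = 0 ∧
          (∀ t : ℝ, deriv Φ t = 0 → t = tstar) ∧
          (∀ t : ℝ, t ≠ tstar → Φ t < Φ tstar) ∧
          0 < Φ tstar ∧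
          ConcaveOn ℝ (Ioi tstar) Φ ∧
          StrictAntiOn Φ (Ioi tstar) ∧
          (deriv Φ 0 < 0 ↔ tstar < 0) := by
  intro u hu huc _ hne hm
  have hN1 : 1 ≤ N := by omega
  have hNR : (3 : ℝ) ≤ N := by exact_mod_cast hN
  have hden : 0 < (N : ℝ) - 2 * a + 2 * b := by linarith
  have hdenp : 0 < (N : ℝ) - 2 * d := by linarith
  have hq : 0 < qc := by rw [hqc]; positivity
  have hp2 : 2 < p := by
    rw [hp, lt_div_iff₀ hdenp]
    linarith
  have hbp : b * p < N := by
    rw [hp, ← mul_div_assoc, div_lt_iff₀ hdenp, hd]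
    nlinarith
  have hexpo : 4 * d / ((N : ℝ) - 2 * a + 2 * b) = qc - 2 := by
    rw [hqc, hd, eq_sub_iff_add_eq, div_add' _ _ _ hden.ne']
    ring
  obtain ⟨hC, hineq⟩ := hCab.1
  have hA : 0 < Aint N a u := Aint_pos hN1 (by linarith) hu huc hne
  have hD : 0 < Bint N b p u := Bint_pos hN1 (by linarith) hbp hu.continuous huc hne
  have hB : Bint N b qc u ≤ Cab ^ qc * ρ ^ (qc - 2) * Aint N a u :=
    le_of_rpow_interpolation hA.le (Bint_nonneg N b qc u) hC.le hρ hq (hm ▸ hineq u hu huc)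
  rw [hexpo] at hβ' ⊢
  have hcoef : 0 < 1 / 2 - β / qc * Cab ^ qc * ρ ^ (qc - 2) := by
    rw [lt_div_iff₀ (by positivity)] at hβ'
    have : β / qc * Cab ^ qc * ρ ^ (qc - 2) = β * (2 * Cab ^ qc * ρ ^ (qc - 2)) / qc / 2 := by
      ring
    have := (div_lt_one hq).2 hβ'
    linarith
  have hlow : (1 / 2 - β / qc * Cab ^ qc * ρ ^ (qc - 2)) * Aint N a u ≤
      1 / 2 * Aint N a u - β / qc * Bint N b qc u := by
    have := mul_le_mul_of_nonneg_left hB (div_pos hβ hq).le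
    linarith
  have hpos := mul_pos hcoef hA
  exact ⟨⟨hlow, hpos⟩, fun Φ hΦ ↦ fiber_geometry (hpos.trans_le hlow) hD hp2 hΦ⟩
end
end

section
/- Let N ≥ 3 be an integer, let a, b be reals with 0 < a < (N−2)/2 and a < b < a+1, set d := 1+a−b, 2♯ := 2N/(N−2d). Fix R > 0 and ζ ∈ C_c^∞(ℝ^N) with 0 ≤ ζ ≤ 1, ζ(x) = 1 for |x| ≤ R and ζ(x) = 0 for |x| ≥ 2R. Set A₀ := ((N−2)/2 − a)², α := 2d(N−2−2a)/(N−2d), U_ε(x) := (2·2♯·A₀·ε)^{(N−2d)/(4d)}/(ε + |x|^α)^{(N−2d)/(2d)} for ε > 0, and u_ε := ζ·U_ε. Then for 2 < q < 2♯, as ε → 0⁺: ∫_{ℝ^N}|x|^{−bq}|u_ε|^q dx = O(ε^{(N−2d)/(4d)}) if 2 < q < N/(N−2−2a+b); ∫_{ℝ^N}|x|^{−bq}|u_ε|^q dx = O(ε^{(2N−Nq+2qd)(N−2d)/(4d(N−2−2a))}·|log ε|) if q = N/(N−2−2a+b); and ∫_{ℝ^N}|x|^{−bq}|u_ε|^q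 dx = O(ε^{(2N−Nq+2qd)(N−2d)/(4d(N−2−2a))}) if N/(N−2−2a+b) < q < 2♯. -/
open MeasureTheory Real Set Filter Asymptotics

noncomputable section

/-- A function on `ℝ^N` bounded by a radial profile, which is `A r^(-β)` with `β < N` for `r ≤ ρ`,
has its integral bounded by the integral of the profile in polar coordinates. -/
lemma integral_le_of_radial_profile {N : ℕ} (hN : 1 ≤ N) {F : E N → ℝ} {g : ℝ → ℝ} {A β ρ : ℝ}
    (hβ : β < N) (hρ : 0 < ρ) (hF : ∀ x, 0 ≤ F x) (hF0 : F 0 = 0)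
    (hFA : ∀ x, 0 < ‖x‖ → ‖x‖ ≤ ρ → F x ≤ A * ‖x‖ ^ (-β))
    (hFg : ∀ x, ρ < ‖x‖ → F x ≤ g ‖x‖)
    (hg : IntegrableOn (fun r => r ^ (N - 1) * g r) (Ioi ρ)) :
    ∫ x, F x ≤ N * volume.real (Metric.ball (0 : E N) 1) *
      (A * (ρ ^ (N - β) / (N - β)) + ∫ r in Ioi ρ, r ^ (N - 1) * g r) := by
  have : Nonempty (Fin N) := ⟨⟨0, hN⟩⟩
  set G : ℝ → ℝ := fun r => if r ≤ 0 then 0 else if r ≤ ρ then A * r ^ (-β) else g r with hG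
  have hcast : ((N - 1 : ℕ) : ℝ) = N - 1 := by push_cast [hN]; ring
  have hI1 : EqOn (fun r => r ^ (N - 1) * G r) (fun r => A * r ^ ((N : ℝ) - 1 - β)) (Ioc 0 ρ) := by
    intro r hr
    simp only [hG, if_neg (not_le.2 hr.1), if_pos hr.2]
    rw [sub_eq_add_neg _ β, rpow_add hr.1, ← hcast, rpow_natCast]
    ring
  have hI2 : EqOn (fun r => r ^ (N - 1) * G r) (fun r => r ^ (N - 1) * g r) (Ioi ρ) := by
    intro r hr
    simp only [hG, if_neg (not_le.2 (hρ.trans (mem_Ioi.1 hr))), if_neg (not_le.2 (mem_Ioi.1 hr))]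
  have ht : -1 < (N : ℝ) - 1 - β := by linarith
  have hi1 : IntegrableOn (fun r => r ^ (N - 1) * G r) (Ioc 0 ρ) := by
    rw [integrableOn_congr_fun hI1 measurableSet_Ioc,
      ← intervalIntegrable_iff_integrableOn_Ioc_of_le hρ.le]
    exact (intervalIntegral.intervalIntegrable_rpow' ht).const_mul A
  have hi2 : IntegrableOn (fun r => r ^ (N - 1) * G r) (Ioi ρ) := by
    rwa [integrableOn_congr_fun hI2 measurableSet_Ioi]
  have hi : IntegrableOn (fun r => r ^ (N - 1) * G r) (Ioi 0) := by
    rw [← Ioc_union_Ioi_eq_Ioi hρ.le]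
    exact hi1.union hi2
  have hint : Integrable (fun x : E N => G ‖x‖) := by
    rw [integrable_fun_norm_addHaar volume (f := G)]
    simpa using hi
  have hval : ∫ r in Ioi (0 : ℝ), r ^ (N - 1) * G r =
      A * (ρ ^ (N - β) / (N - β)) + ∫ r in Ioi ρ, r ^ (N - 1) * g r := by
    rw [← Ioc_union_Ioi_eq_Ioi hρ.le,
      setIntegral_union (Ioc_disjoint_Ioi le_rfl) measurableSet_Ioi hi1 hi2,
      setIntegral_congr_fun measurableSet_Ioc hI1, setIntegral_congr_fun measurableSet_Ioi hI2,
      ← intervalIntegral.integral_of_le hρ.le, intervalIntegral.integral_const_mul,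
      integral_rpow (Or.inl ht), show (N : ℝ) - 1 - β + 1 = N - β by ring,
      zero_rpow (by linarith), sub_zero]
  calc ∫ x, F x ≤ ∫ x : E N, G ‖x‖ := by
        refine integral_mono_of_nonneg (Eventually.of_forall hF) hint (Eventually.of_forall ?_)
        intro x
        rcases (norm_nonneg x).eq_or_lt with h | h
        · have hx : x = 0 := norm_eq_zero.1 h.symm
          simp [hG, hx, hF0]
        · rcases le_or_gt ‖x‖ ρ with h' | h'
          · simpa [hG, if_neg (not_le.2 h), h'] using hFA x h h'
          · simpa only [hG, if_neg (not_le.2 h), if_neg (not_le.2 h')] using hFg x h'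
    _ = _ := by
        rw [integral_fun_norm_addHaar volume G]
        simp only [smul_eq_mul, finrank_euclideanSpace_fin, nsmul_eq_mul, hval]
        ring

/-- Proposition A.1(iii): asymptotics of the weighted `L^q` norms of the truncated bubbles
`u_ε = ζ U_ε` as `ε → 0⁺`, in the three regimes `q < N/(N-2-2a+b)`, `q = N/(N-2-2a+b)`
and `q > N/(N-2-2a+b)`. -/
theorem bubble_Lq_asymptotics (N : ℕ) (hN : 3 ≤ N) (a b d p q R A₀ α : ℝ)
    (ha : 0 < a) (ha' : a < ((N : ℝ) - 2) / 2) (hab : a < b) (hb : b < a + 1)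
    (hd : d = 1 + a - b) (hp : p = 2 * N / ((N : ℝ) - 2 * d))
    (hq : 2 < q) (hq' : q < p)
    (hA₀ : A₀ = (((N : ℝ) - 2) / 2 - a) ^ 2)
    (hα : α = 2 * d * ((N : ℝ) - 2 - 2 * a) / ((N : ℝ) - 2 * d))
    (hR : 0 < R)
    (ζ : E N → ℝ) (hζ : ContDiff ℝ (⊤ : ℕ∞) ζ) (hζc : HasCompactSupport ζ)
    (hζ0 : ∀ x, 0 ≤ ζ x) (hζ1 : ∀ x, ζ x ≤ 1)
    (hζR : ∀ x : E N, ‖x‖ ≤ R → ζ x = 1) (hζ2R : ∀ x : E N, 2 * R ≤ ‖x‖ → ζ x = 0)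
    (uε : ℝ → E N → ℝ)
    (huε : ∀ ε : ℝ, ∀ x : E N, uε ε x =
      ζ x * ((2 * p * A₀ * ε) ^ (((N : ℝ) - 2 * d) / (4 * d)) /
        (ε + ‖x‖ ^ α) ^ (((N : ℝ) - 2 * d) / (2 * d)))) :
    (q < (N : ℝ) / ((N : ℝ) - 2 - 2 * a + b) →
      (fun ε : ℝ => ∫ x : E N, ‖x‖ ^ (-(b * q)) * |uε ε x| ^ q)
        =O[nhdsWithin 0 (Ioi 0)] fun ε : ℝ => ε ^ (((N : ℝ) - 2 * d) / (4 * d))) ∧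
    (q = (N : ℝ) / ((N : ℝ) - 2 - 2 * a + b) →
      (fun ε : ℝ => ∫ x : E N, ‖x‖ ^ (-(b * q)) * |uε ε x| ^ q)
        =O[nhdsWithin 0 (Ioi 0)] fun ε : ℝ =>
          ε ^ ((2 * (N : ℝ) - (N : ℝ) * q + 2 * q * d) * ((N : ℝ) - 2 * d) /
            (4 * d * ((N : ℝ) - 2 - 2 * a))) * |Real.log ε|) ∧
    ((N : ℝ) / ((N : ℝ) - 2 - 2 * a + b) < q →
      (fun ε : ℝ => ∫ x : E N, ‖x‖ ^ (-(b * q)) * |uε ε x| ^ q)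
        =O[nhdsWithin 0 (Ioi 0)] fun ε : ℝ =>
          ε ^ ((2 * (N : ℝ) - (N : ℝ) * q + 2 * q * d) * ((N : ℝ) - 2 * d) /
            (4 * d * ((N : ℝ) - 2 - 2 * a)))) := by
  have hN3 : (3 : ℝ) ≤ N := by exact_mod_cast hN
  have hd0 : 0 < d := by linarith
  have hNd : 0 < (N : ℝ) - 2 * d := by linarith
  have hb0 : 0 < b := ha.trans hab
  have hq0 : 0 < q := by linarith
  set γ : ℝ := (N : ℝ) - 2 - 2 * a with hγ
  have hγ0 : 0 < γ := by linarith
  have hα0 : 0 < α := by rw [hα]; positivity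
  set s : ℝ := ((N : ℝ) - 2 * d) / (4 * d) with hs
  have hs0 : 0 < s := by positivity
  have hs2 : ((N : ℝ) - 2 * d) / (2 * d) = 2 * s := by rw [hs]; field_simp; ring
  have hαs : α * (2 * s) = γ := by rw [hα, hs]; field_simp; ring
  rw [hs2] at huε
  have hp0 : 0 < p := by rw [hp]; positivity
  have hA0 : 0 ≤ A₀ := by rw [hA₀]; positivity
  have hbqN : b * q < N := by
    rw [hp, lt_div_iff₀ hNd] at hq'
    nlinarith
  have hexp : (2 * (N : ℝ) - (N : ℝ) * q + 2 * q * d) * ((N : ℝ) - 2 * d) / (4 * d * γ) =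
      s * q + -(2 * s * q) + (N - b * q) / α := by
    rw [hα, hs]
    have : b = 1 + a - d := by linarith
    rw [this]
    field_simp
    rw [hγ]
    ring
  set K : ℝ := ((2 * p * A₀) ^ s) ^ q with hK
  have hK0 : 0 ≤ K := by positivity
  set F : ℝ → E N → ℝ := fun ε x => ‖x‖ ^ (-(b * q)) * |uε ε x| ^ q with hF
  have hFnn : ∀ ε x, 0 ≤ F ε x := fun ε x => by positivity
  have hFzero : ∀ ε, F ε 0 = 0 := fun ε => by
    simp only [hF, norm_zero]
    rw [zero_rpow (neg_ne_zero.2 (mul_pos hb0 hq0).ne'), zero_mul]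
  have hFout : ∀ ε x, 2 * R ≤ ‖x‖ → F ε x = 0 := fun ε x hx => by
    simp [hF, huε, hζ2R x hx, zero_rpow hq0.ne']
  have hFle : ∀ ε x, 0 < ε →
      F ε x ≤ K * ε ^ (s * q) * (‖x‖ ^ (-(b * q)) * (ε + ‖x‖ ^ α) ^ (-(2 * s * q))) := by
    intro ε x hε
    have h1 : 0 ≤ ‖x‖ ^ α := by positivity
    have h2 : |uε ε x| ≤ (2 * p * A₀ * ε) ^ s / (ε + ‖x‖ ^ α) ^ (2 * s) := by
      rw [huε, abs_of_nonneg (mul_nonneg (hζ0 x) (by positivity))]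
      exact mul_le_of_le_one_left (by positivity) (hζ1 x)
    have h3 : |uε ε x| ^ q ≤ K * ε ^ (s * q) * (ε + ‖x‖ ^ α) ^ (-(2 * s * q)) := by
      refine (rpow_le_rpow (abs_nonneg _) h2 hq0.le).trans_eq ?_
      rw [div_rpow (by positivity) (by positivity), mul_rpow (by positivity) hε.le,
        mul_rpow (by positivity) (by positivity), rpow_neg (by positivity), ← hK,
        rpow_mul (by positivity : 0 ≤ ε + ‖x‖ ^ α) (2 * s) q, rpow_mul hε.le s q, div_eq_mul_inv]
    calc F ε x ≤ ‖x‖ ^ (-(b * q)) * (K * ε ^ (s * q) * (ε + ‖x‖ ^ α) ^ (-(2 * s * q))) :=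
          mul_le_mul_of_nonneg_left h3 (by positivity)
      _ = _ := by ring
  have hsq : -(2 * s * q) ≤ 0 := by nlinarith [mul_pos hs0 hq0]
  have hFnear : ∀ ε x, 0 < ε →
      F ε x ≤ K * ε ^ (s * q + -(2 * s * q)) * ‖x‖ ^ (-(b * q)) := by
    intro ε x hε
    have h1 : 0 ≤ ‖x‖ ^ α := by positivity
    refine (hFle ε x hε).trans ?_
    have h2 : (ε + ‖x‖ ^ α) ^ (-(2 * s * q)) ≤ ε ^ (-(2 * s * q)) :=
      rpow_le_rpow_of_nonpos hε (le_add_of_nonneg_right h1) hsq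
    calc K * ε ^ (s * q) * (‖x‖ ^ (-(b * q)) * (ε + ‖x‖ ^ α) ^ (-(2 * s * q)))
        ≤ K * ε ^ (s * q) * (‖x‖ ^ (-(b * q)) * ε ^ (-(2 * s * q))) := by gcongr
      _ = _ := by
        rw [rpow_add hε]
        ring
  have hFfar : ∀ ε x, 0 < ε → 0 < ‖x‖ →
      F ε x ≤ K * ε ^ (s * q) * ‖x‖ ^ (-((γ + b) * q)) := by
    intro ε x hε hx
    have h1 : 0 < ‖x‖ ^ α := by positivity
    refine (hFle ε x hε).trans ?_
    have h2 : (ε + ‖x‖ ^ α) ^ (-(2 * s * q)) ≤ ‖x‖ ^ (-(γ * q)) := by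
      refine (rpow_le_rpow_of_nonpos h1 (by linarith) hsq).trans_eq ?_
      rw [← rpow_mul hx.le, ← hαs]
      congr 1
      ring
    rw [show -((γ + b) * q) = -(b * q) + -(γ * q) by ring, rpow_add hx]
    gcongr
  set V : ℝ := N * volume.real (Metric.ball (0 : E N) 1) with hV
  have hV0 : 0 ≤ V := by positivity
  have hcast : ((N - 1 : ℕ) : ℝ) = N - 1 := by push_cast [show 1 ≤ N by omega]; ring
  have hpow : ∀ ε t : ℝ, 0 < ε → (ε ^ (1 / α)) ^ t = ε ^ (t / α) := fun ε t hε => by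
    rw [← rpow_mul hε.le]
    congr 1
    ring
  have hγb : 0 < γ + b := by linarith
  refine ⟨fun h => ?_, fun h => ?_, fun h => ?_⟩
  · rw [lt_div_iff₀ hγb, mul_comm] at h
    refine IsBigO.of_bound (V * (K * ((2 * R) ^ (N - (γ + b) * q) / (N - (γ + b) * q)))) ?_
    filter_upwards [Ioo_mem_nhdsGT one_pos] with ε hε
    have hle := integral_le_of_radial_profile (by omega : 1 ≤ N) (F := F ε) (g := fun _ => 0)
      (A := K * ε ^ (s * q)) h (by positivity : 0 < 2 * R) (hFnn ε) (hFzero ε)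
      (fun x hx _ => hFfar ε x hε.1 hx) (fun x hx => (hFout ε x hx.le).le)
      (by simp)
    rw [norm_of_nonneg (integral_nonneg (hFnn ε)), norm_of_nonneg (rpow_nonneg hε.1.le _)]
    refine hle.trans ?_
    simp only [mul_zero, integral_zero, add_zero]
    have hεs : ε ^ (s * q) ≤ ε ^ s := by
      refine rpow_le_rpow_of_exponent_ge hε.1 hε.2.le ?_
      nlinarith
    have hc : 0 ≤ (2 * R) ^ (N - (γ + b) * q) / (N - (γ + b) * q) :=
      div_nonneg (by positivity) (by linarith)
    calc V * (K * ε ^ (s * q) * ((2 * R) ^ (N - (γ + b) * q) / (N - (γ + b) * q)))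
        = V * (K * ((2 * R) ^ (N - (γ + b) * q) / (N - (γ + b) * q))) * ε ^ (s * q) := by ring
      _ ≤ _ := by gcongr
  · rw [eq_div_iff hγb.ne', mul_comm] at h
    rw [hexp]
    refine IsBigO.of_bound (V * (K * (1 / (N - b * q) + (|Real.log (2 * R)| + 1 / α)))) ?_
    have hR' : 0 < (2 * R) ^ α := by positivity
    filter_upwards [Ioo_mem_nhdsGT hR', Ioo_mem_nhdsGT (Real.exp_pos (-1))] with ε hεR hεe
    have hε : 0 < ε := hεR.1
    have hρ : 0 < ε ^ (1 / α) := by positivity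
    have hρR : ε ^ (1 / α) ≤ 2 * R := by
      have := rpow_le_rpow hε.le hεR.2.le (by positivity : 0 ≤ 1 / α)
      rwa [← rpow_mul (by positivity), mul_one_div_cancel hα0.ne', rpow_one] at this
    have hlog : Real.log ε < -1 := (Real.log_lt_iff_lt_exp hε).2 hεe.2
    have hE : EqOn (fun r : ℝ => r ^ (N - 1) *
          (Iic (2 * R)).indicator (fun r => K * ε ^ (s * q) * r ^ (-((γ + b) * q))) r)
        ((Iic (2 * R)).indicator fun r => K * ε ^ (s * q) * r⁻¹) (Ioi (ε ^ (1 / α))) := by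
      intro r hr
      have hr0 : 0 < r := hρ.trans hr
      by_cases hr2 : r ∈ Iic (2 * R)
      · simp only [indicator_of_mem hr2]
        have : r⁻¹ = r ^ (N - 1) * r ^ (-(N : ℝ)) := by
          rw [← rpow_natCast, ← rpow_add hr0, hcast, ← rpow_neg_one]
          congr 1
          ring
        rw [h, this]
        ring
      · simp only [indicator_of_notMem hr2, mul_zero]
    have hinv : IntegrableOn (fun r : ℝ => K * ε ^ (s * q) * r⁻¹) (Ioc (ε ^ (1 / α)) (2 * R)) := by
      rw [← intervalIntegrable_iff_integrableOn_Ioc_of_le hρR]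
      refine (intervalIntegrable_inv_iff.2 (Or.inr ?_)).const_mul _
      rw [uIcc_of_le hρR]
      exact fun h0 => absurd h0.1 (not_le.2 hρ)
    have hle := integral_le_of_radial_profile (by omega : 1 ≤ N) (F := F ε)
      (g := (Iic (2 * R)).indicator fun r => K * ε ^ (s * q) * r ^ (-((γ + b) * q)))
      (A := K * ε ^ (s * q + -(2 * s * q))) hbqN hρ (hFnn ε) (hFzero ε)
      (fun x _ _ => hFnear ε x hε)
      (fun x hx => by
        by_cases hx2 : ‖x‖ ∈ Iic (2 * R)
        · rw [indicator_of_mem hx2]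
          exact hFfar ε x hε (hρ.trans hx)
        · rw [indicator_of_notMem hx2]
          exact (hFout ε x (not_le.1 hx2).le).le)
      (by
        rw [integrableOn_congr_fun hE measurableSet_Ioi, IntegrableOn,
          integrable_indicator_iff measurableSet_Iic, IntegrableOn,
          Measure.restrict_restrict measurableSet_Iic, inter_comm, Ioi_inter_Iic]
        exact hinv)
    rw [setIntegral_congr_fun measurableSet_Ioi hE, setIntegral_indicator measurableSet_Iic,
      Ioi_inter_Iic, ← intervalIntegral.integral_of_le hρR, intervalIntegral.integral_const_mul,
      integral_inv_of_pos hρ (by positivity), Real.log_div (by positivity) hρ.ne',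
      Real.log_rpow hε, hpow ε _ hε] at hle
    have hcrit : s * q + -(2 * s * q) + (N - b * q) / α = s * q := by
      have : (N - b * q) / α = 2 * s * q := by
        rw [div_eq_iff hα0.ne', ← h, ← hαs]
        ring
      rw [this]
      ring
    rw [norm_of_nonneg (integral_nonneg (hFnn ε)), hcrit,
      norm_of_nonneg (mul_nonneg (rpow_nonneg hε.le _) (abs_nonneg _))]
    refine hle.trans ?_
    have habs : |Real.log ε| = -Real.log ε := abs_of_neg (by linarith)
    have hL1 : 1 ≤ |Real.log ε| := by linarith
    have hbq : 0 < N - b * q := by linarith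
    have h1 : Real.log (2 * R) - 1 / α * Real.log ε ≤
        (|Real.log (2 * R)| + 1 / α) * |Real.log ε| := by
      have := le_abs_self (Real.log (2 * R))
      have := mul_le_mul_of_nonneg_left hL1 (abs_nonneg (Real.log (2 * R)))
      rw [add_mul, habs] at *
      linarith
    have h2 : 1 / (N - b * q) ≤ 1 / (N - b * q) * |Real.log ε| :=
      le_mul_of_one_le_right (by positivity) hL1
    have h3 : ε ^ (s * q + -(2 * s * q)) * ε ^ ((N - b * q) / α) = ε ^ (s * q) := by
      rw [← rpow_add hε, hcrit]
    calc V * (K * ε ^ (s * q + -(2 * s * q)) * (ε ^ ((N - b * q) / α) / (N - b * q)) +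
          K * ε ^ (s * q) * (Real.log (2 * R) - 1 / α * Real.log ε))
        = V * (K * ε ^ (s * q) *
          (1 / (N - b * q) + (Real.log (2 * R) - 1 / α * Real.log ε))) := by
          rw [← h3]
          ring
      _ ≤ V * (K * ε ^ (s * q) * (1 / (N - b * q) * |Real.log ε| +
          (|Real.log (2 * R)| + 1 / α) * |Real.log ε|)) := by gcongr
      _ = _ := by ring
  · rw [div_lt_iff₀ hγb, mul_comm] at h
    rw [hexp]
    refine IsBigO.of_bound (V * (K * (1 / (N - b * q) + 1 / ((γ + b) * q - N)))) ?_
    filter_upwards [self_mem_nhdsWithin] with ε (hε : 0 < ε)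
    have hρ : 0 < ε ^ (1 / α) := by positivity
    have ht : (N : ℝ) - 1 - (γ + b) * q < -1 := by linarith
    have hE : EqOn (fun r : ℝ => r ^ (N - 1) * (K * ε ^ (s * q) * r ^ (-((γ + b) * q))))
        (fun r => K * ε ^ (s * q) * r ^ ((N : ℝ) - 1 - (γ + b) * q)) (Ioi (ε ^ (1 / α))) := by
      intro r hr
      simp only
      rw [sub_eq_add_neg _ ((γ + b) * q), rpow_add (hρ.trans hr), ← hcast, rpow_natCast]
      ring
    have hle := integral_le_of_radial_profile (by omega : 1 ≤ N) (F := F ε)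
      (g := fun r => K * ε ^ (s * q) * r ^ (-((γ + b) * q)))
      (A := K * ε ^ (s * q + -(2 * s * q))) hbqN hρ (hFnn ε) (hFzero ε)
      (fun x _ _ => hFnear ε x hε) (fun x hx => hFfar ε x hε (hρ.trans hx))
      (by
        rw [integrableOn_congr_fun hE measurableSet_Ioi]
        exact (integrableOn_Ioi_rpow_of_lt ht hρ).const_mul _)
    rw [setIntegral_congr_fun measurableSet_Ioi hE, integral_const_mul,
      integral_Ioi_rpow_of_lt ht hρ, hpow ε _ hε, hpow ε _ hε] at hle
    rw [norm_of_nonneg (integral_nonneg (hFnn ε)), norm_of_nonneg (rpow_nonneg hε.le _)]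
    refine hle.trans_eq ?_
    have h3 : ε ^ (s * q) * ε ^ (((N : ℝ) - 1 - (γ + b) * q + 1) / α) =
        ε ^ (s * q + -(2 * s * q)) * ε ^ ((N - b * q) / α) := by
      rw [← rpow_add hε, ← rpow_add hε]
      congr 1
      rw [← hαs]
      field_simp
      ring
    have h4 : (N : ℝ) - 1 - (γ + b) * q + 1 = -((γ + b) * q - N) := by ring
    rw [rpow_add hε _ ((N - b * q) / α), ← hV]
    calc V * (K * ε ^ (s * q + -(2 * s * q)) * (ε ^ ((N - b * q) / α) / (N - b * q)) +
          K * ε ^ (s * q) * (-ε ^ (((N : ℝ) - 1 - (γ + b) * q + 1) / α) /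
            ((N : ℝ) - 1 - (γ + b) * q + 1)))
        = V * (K * (ε ^ (s * q + -(2 * s * q)) * ε ^ ((N - b * q) / α) / (N - b * q) +
          ε ^ (s * q) * ε ^ (((N : ℝ) - 1 - (γ + b) * q + 1) / α) / ((γ + b) * q - N))) := by
          nth_rewrite 2 [h4]
          rw [neg_div_neg_eq]
          ring
      _ = _ := by
          rw [h3]
          ring
end
end

section
/- Let N ≥ 3 be an integer, let a, b be reals with 0 < a < (N−2)/2 and a < b < a+1, set d := 1+a−b, 2♯ := 2N/(N−2d). Fix R > 0 and ζ ∈ C_c^∞(ℝ^N) with 0 ≤ ζ ≤ 1, ζ(x) = 1 for |x| ≤ R and ζ(x) = 0 for |x| ≥ 2R. Set A₀ := ((N−2)/2 − a)², α := 2d(N−2−2a)/(N−2d), U_ε(x) := (2·2♯·A₀·ε)^{(N−2d)/(4d)}/(ε + |x|^α)^{(N−2d)/(2d)} for ε > 0, and u_ε := ζ·U_ε. Then, as ε → 0⁺: ∫_{ℝ^N}|x|^{−2a}|u_ε|² dx = O(ε^{(N−2d)/(d(N−2−2a))}) if 0 < a < max{0,(N−4)/2}; ∫_{ℝ^N}|x|^{−2a}|u_ε|²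 dx = O(ε^{(N−2d)/(d(N−2−2a))}·|log ε|) if 0 < a = (N−4)/2; and ∫_{ℝ^N}|x|^{−2a}|u_ε|² dx = O(ε^{(N−2d)/(2d)}) if max{0,(N−4)/2} < a < (N−2)/2. -/
open MeasureTheory Real Set Filter Asymptotics

noncomputable section

/-- A nonnegative function on `ℝ^N` with a radial majorant is controlled by a one-dimensional
integral. -/
lemma integral_le_of_radial_majorant {N : ℕ} (hN : 0 < N) {F : E N → ℝ} {φ : ℝ → ℝ}
    (hF : ∀ x, 0 ≤ F x) (hφ : IntegrableOn φ (Ioi 0))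
    (hle : ∀ x, x ≠ 0 → F x * ‖x‖ ^ (N - 1) ≤ φ ‖x‖) :
    ∫ x, F x ≤ N * volume.real (Metric.ball (0 : E N) 1) * ∫ y in Ioi (0 : ℝ), φ y := by
  have : Nonempty (Fin N) := ⟨⟨0, hN⟩⟩
  have hcongr : EqOn (fun y : ℝ => y ^ (N - 1) • (φ y / y ^ (N - 1))) φ (Ioi 0) := by
    intro y hy
    have : y ^ (N - 1) ≠ 0 := pow_ne_zero _ (ne_of_gt hy)
    simp only [smul_eq_mul]
    field_simp
  have hint : Integrable (fun x : E N => φ ‖x‖ / ‖x‖ ^ (N - 1)) := by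
    refine (integrable_fun_norm_addHaar (volume : Measure (E N))
      (f := fun y => φ y / y ^ (N - 1))).2 ?_
    rw [finrank_euclideanSpace_fin]
    exact hφ.congr_fun hcongr.symm measurableSet_Ioi
  have hval := integral_fun_norm_addHaar (volume : Measure (E N)) (fun y => φ y / y ^ (N - 1))
  rw [finrank_euclideanSpace_fin, setIntegral_congr_fun measurableSet_Ioi hcongr,
    nsmul_eq_mul, smul_eq_mul, ← mul_assoc] at hval
  rw [← hval]
  refine integral_mono_of_nonneg (Eventually.of_forall hF) hint ?_
  have h0 : ∀ᵐ x : E N, x ≠ 0 := by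
    simp [ae_iff]
  filter_upwards [h0] with x hx
  have : 0 < ‖x‖ ^ (N - 1) := pow_pos (norm_pos_iff.2 hx) _
  rw [le_div_iff₀ this]
  exact hle x hx

/-- Reduction of the weighted mass of a truncated bubble to a one-dimensional integral. -/
lemma truncated_bubble_mass_le {N : ℕ} (hN : 0 < N) {a α k c ε R : ℝ} {ζ : E N → ℝ}
    (hζ0 : ∀ x, 0 ≤ ζ x) (hζ1 : ∀ x, ζ x ≤ 1) (hζ2R : ∀ x : E N, 2 * R ≤ ‖x‖ → ζ x = 0)
    (hc : 0 ≤ c) (hε : 0 < ε) {φ : ℝ → ℝ} (hφ0 : ∀ y, 0 < y → 0 ≤ φ y)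
    (hφ : IntegrableOn φ (Ioi 0))
    (hle : ∀ y, 0 < y → y < 2 * R → y ^ ((N : ℝ) - 1 - 2 * a) / (ε + y ^ α) ^ (2 * k) ≤ φ y) :
    ∫ x : E N, ‖x‖ ^ (-(2 * a)) * (ζ x * (c ^ (k / 2) / (ε + ‖x‖ ^ α) ^ k)) ^ 2 ≤
      N * volume.real (Metric.ball (0 : E N) 1) * (c ^ k * ∫ y in Ioi (0 : ℝ), φ y) := by
  have hck : 0 ≤ c ^ k := rpow_nonneg hc _
  rw [← integral_const_mul]
  refine integral_le_of_radial_majorant hN (fun x => by positivity) (hφ.const_mul _) ?_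
  intro x hx
  have hr : 0 < ‖x‖ := norm_pos_iff.2 hx
  rcases le_or_gt (2 * R) ‖x‖ with h | h
  · rw [hζ2R x h]
    simpa using mul_nonneg hck (hφ0 _ hr)
  · have hpos : 0 < ε + ‖x‖ ^ α := by positivity
    have e1 : (c ^ (k / 2)) ^ 2 = c ^ k := by
      rw [← rpow_natCast, ← rpow_mul hc]; congr 1; push_cast; ring
    have e2 : ((ε + ‖x‖ ^ α) ^ k) ^ 2 = (ε + ‖x‖ ^ α) ^ (2 * k) := by
      rw [← rpow_natCast, ← rpow_mul hpos.le]; congr 1; push_cast; ring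
    have e3 : ‖x‖ ^ (-(2 * a)) * ‖x‖ ^ (N - 1) = ‖x‖ ^ ((N : ℝ) - 1 - 2 * a) := by
      rw [← rpow_natCast, ← rpow_add hr, Nat.cast_sub hN]; congr 1; push_cast; ring
    have hz : ζ x ^ 2 ≤ 1 := pow_le_one₀ (hζ0 x) (hζ1 x)
    calc ‖x‖ ^ (-(2 * a)) * (ζ x * (c ^ (k / 2) / (ε + ‖x‖ ^ α) ^ k)) ^ 2 * ‖x‖ ^ (N - 1)
        = ζ x ^ 2 * (c ^ k * (‖x‖ ^ ((N : ℝ) - 1 - 2 * a) / (ε + ‖x‖ ^ α) ^ (2 * k))) := by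
          rw [mul_pow, div_pow, e1, e2, ← e3]; ring
      _ ≤ 1 * (c ^ k * (‖x‖ ^ ((N : ℝ) - 1 - 2 * a) / (ε + ‖x‖ ^ α) ^ (2 * k))) := by
          gcongr
      _ ≤ c ^ k * φ ‖x‖ := by
          rw [one_mul]
          exact mul_le_mul_of_nonneg_left (hle _ hr h) hck

lemma bubble_density_le_of_eps {ε y α k m : ℝ} (hε : 0 < ε) (hy : 0 < y) (hk : 0 ≤ k) :
    y ^ m / (ε + y ^ α) ^ (2 * k) ≤ ε ^ (-(2 * k)) * y ^ m := by
  rw [rpow_neg hε.le, div_eq_inv_mul]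
  gcongr
  linarith [rpow_pos_of_pos hy α]

lemma bubble_density_le_of_radius {ε y α k m : ℝ} (hε : 0 < ε) (hy : 0 < y) (hk : 0 ≤ k) :
    y ^ m / (ε + y ^ α) ^ (2 * k) ≤ y ^ (m - 2 * (α * k)) := by
  have e : y ^ (m - 2 * (α * k)) = y ^ m / (y ^ α) ^ (2 * k) := by
    rw [← rpow_mul hy.le, rpow_sub hy]; congr 2; ring
  rw [e]
  gcongr
  linarith

lemma integrableOn_Ioc_rpow {s r : ℝ} (hr : 0 ≤ r) (hs : -1 < s) :
    IntegrableOn (fun y : ℝ => y ^ s) (Ioc 0 r) :=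
  (intervalIntegrable_iff_integrableOn_Ioc_of_le hr).1
    (intervalIntegral.intervalIntegrable_rpow' hs)

lemma setIntegral_Ioc_rpow {s r : ℝ} (hr : 0 ≤ r) (hs : -1 < s) :
    ∫ y in Ioc 0 r, y ^ s = r ^ (s + 1) / (s + 1) := by
  rw [← intervalIntegral.integral_of_le hr, integral_rpow (Or.inl hs),
    zero_rpow (by linarith), sub_zero]

/-- Integrability and value of a function on the half line glued from an inner piece on `(0, r]`
and an outer piece supported on a set `t` beyond `r`. -/
lemma integrableOn_and_integral_glue {f g : ℝ → ℝ} {r : ℝ} {t : Set ℝ} (ht : MeasurableSet t)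
    (hr : 0 ≤ r) (htr : t ⊆ Ioi r) (hf : IntegrableOn f (Ioc 0 r)) (hg : IntegrableOn g t) :
    IntegrableOn (fun y => (Ioc 0 r).indicator f y + t.indicator g y) (Ioi 0) ∧
    ∫ y in Ioi (0 : ℝ), ((Ioc 0 r).indicator f y + t.indicator g y) =
      (∫ y in Ioc 0 r, f y) + ∫ y in t, g y := by
  have hf' : Integrable ((Ioc 0 r).indicator f) := hf.integrable_indicator measurableSet_Ioc
  have hg' : Integrable (t.indicator g) := hg.integrable_indicator ht
  refine ⟨(hf'.add hg').integrableOn, ?_⟩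
  rw [integral_add hf'.integrableOn hg'.integrableOn, setIntegral_indicator measurableSet_Ioc,
    setIntegral_indicator ht, inter_eq_self_of_subset_right Ioc_subset_Ioi_self,
    inter_eq_self_of_subset_right (htr.trans (Ioi_subset_Ioi hr))]

/-- Proposition A.1(iv): asymptotics of the weighted mass `∫|x|^{-2a}|u_ε|²` of the
truncated bubbles `u_ε = ζ U_ε` as `ε → 0⁺`, in the three regimes
`a < max{0,(N-4)/2}`, `a = (N-4)/2` and `a > max{0,(N-4)/2}`. -/
theorem bubble_mass_asymptotics (N : ℕ) (hN : 3 ≤ N) (a b d p R A₀ α : ℝ)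
    (ha : 0 < a) (ha' : a < ((N : ℝ) - 2) / 2) (hab : a < b) (hb : b < a + 1)
    (hd : d = 1 + a - b) (hp : p = 2 * N / ((N : ℝ) - 2 * d))
    (hA₀ : A₀ = (((N : ℝ) - 2) / 2 - a) ^ 2)
    (hα : α = 2 * d * ((N : ℝ) - 2 - 2 * a) / ((N : ℝ) - 2 * d))
    (hR : 0 < R)
    (ζ : E N → ℝ) (hζ : ContDiff ℝ (⊤ : ℕ∞) ζ) (hζc : HasCompactSupport ζ)
    (hζ0 : ∀ x, 0 ≤ ζ x) (hζ1 : ∀ x, ζ x ≤ 1)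
    (hζR : ∀ x : E N, ‖x‖ ≤ R → ζ x = 1) (hζ2R : ∀ x : E N, 2 * R ≤ ‖x‖ → ζ x = 0)
    (uε : ℝ → E N → ℝ)
    (huε : ∀ ε : ℝ, ∀ x : E N, uε ε x =
      ζ x * ((2 * p * A₀ * ε) ^ (((N : ℝ) - 2 * d) / (4 * d)) /
        (ε + ‖x‖ ^ α) ^ (((N : ℝ) - 2 * d) / (2 * d)))) :
    (a < max 0 (((N : ℝ) - 4) / 2) →
      (fun ε : ℝ => ∫ x : E N, ‖x‖ ^ (-(2 * a)) * (uε ε x) ^ 2)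
        =O[nhdsWithin 0 (Ioi 0)] fun ε : ℝ =>
          ε ^ (((N : ℝ) - 2 * d) / (d * ((N : ℝ) - 2 - 2 * a)))) ∧
    (a = ((N : ℝ) - 4) / 2 →
      (fun ε : ℝ => ∫ x : E N, ‖x‖ ^ (-(2 * a)) * (uε ε x) ^ 2)
        =O[nhdsWithin 0 (Ioi 0)] fun ε : ℝ =>
          ε ^ (((N : ℝ) - 2 * d) / (d * ((N : ℝ) - 2 - 2 * a))) * |Real.log ε|) ∧
    (max 0 (((N : ℝ) - 4) / 2) < a →
      (fun ε : ℝ => ∫ x : E N, ‖x‖ ^ (-(2 * a)) * (uε ε x) ^ 2)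
        =O[nhdsWithin 0 (Ioi 0)] fun ε : ℝ =>
          ε ^ (((N : ℝ) - 2 * d) / (2 * d))) := by
  have hN' : (3 : ℝ) ≤ N := by exact_mod_cast hN
  have hd0 : 0 < d := by linarith
  have hd1 : d < 1 := by linarith
  have hNd : 0 < (N : ℝ) - 2 * d := by linarith
  have hq : 0 < (N : ℝ) - 2 - 2 * a := by linarith
  obtain ⟨k, hk⟩ : ∃ k, k = ((N : ℝ) - 2 * d) / (2 * d) := ⟨_, rfl⟩
  have hk0 : 0 < k := by rw [hk]; positivity
  have hα0 : 0 < α := by rw [hα]; positivity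
  have hαk : α * k = (N : ℝ) - 2 - 2 * a := by rw [hα, hk]; field_simp
  have hk2 : ((N : ℝ) - 2 * d) / (4 * d) = k / 2 := by rw [hk]; field_simp; norm_num
  have hexp : ((N : ℝ) - 2 * d) / (d * ((N : ℝ) - 2 - 2 * a)) = 2 / α := by
    rw [hα]; field_simp
  have hA0 : 0 ≤ A₀ := by rw [hA₀]; positivity
  have hp0 : 0 ≤ p := by rw [hp]; positivity
  obtain ⟨m, hm⟩ : ∃ m, m = (N : ℝ) - 1 - 2 * a := ⟨_, rfl⟩
  obtain ⟨s, hs⟩ : ∃ s, s = m - 2 * (α * k) := ⟨_, rfl⟩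
  have hs' : s = 3 + 2 * a - N := by rw [hs, hm, hαk]; ring
  have hm1 : -1 < m := by linarith
  rw [hexp, ← hk]
  -- Any family of one-dimensional majorants whose integral scales like `ε ^ (-k) * G ε` suffices.
  have key : ∀ (G : ℝ → ℝ) (C : ℝ), (∀ᶠ ε : ℝ in nhdsWithin 0 (Ioi 0), ∃ φ : ℝ → ℝ,
      (∀ y, 0 < y → 0 ≤ φ y) ∧ IntegrableOn φ (Ioi 0) ∧
      (∀ y, 0 < y → y < 2 * R → y ^ m / (ε + y ^ α) ^ (2 * k) ≤ φ y) ∧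
      ε ^ k * ∫ y in Ioi (0 : ℝ), φ y ≤ C * ‖G ε‖) →
      (fun ε : ℝ => ∫ x : E N, ‖x‖ ^ (-(2 * a)) * (uε ε x) ^ 2)
        =O[nhdsWithin 0 (Ioi 0)] G := by
    intro G C hev
    refine IsBigO.of_bound
      (N * volume.real (Metric.ball (0 : E N) 1) * ((2 * p * A₀) ^ k * C)) ?_
    filter_upwards [hev, self_mem_nhdsWithin] with ε hφ hε
    obtain ⟨φ, hφ0, hφi, hle, hint⟩ := hφ
    have hε : 0 < ε := hε
    simp_rw [huε, hk2, ← hk]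
    rw [norm_of_nonneg (integral_nonneg fun x => by positivity)]
    refine (truncated_bubble_mass_le (by omega) hζ0 hζ1 hζ2R (by positivity) hε hφ0 hφi
      (hm ▸ hle)).trans ?_
    rw [mul_rpow (by positivity) hε.le]
    calc N * volume.real (Metric.ball (0 : E N) 1) *
          ((2 * p * A₀) ^ k * ε ^ k * ∫ y in Ioi (0 : ℝ), φ y)
        = N * volume.real (Metric.ball (0 : E N) 1) *
          ((2 * p * A₀) ^ k * (ε ^ k * ∫ y in Ioi (0 : ℝ), φ y)) := by ring
      _ ≤ N * volume.real (Metric.ball (0 : E N) 1) *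
          ((2 * p * A₀) ^ k * (C * ‖G ε‖)) := by gcongr
      _ = _ := by ring
  have hglue : ∀ (ε r : ℝ) (t : Set ℝ), 0 < ε → 0 < r → t ⊆ Ioi r → Ioo r (2 * R) ⊆ t →
      (∀ y, 0 < y → 0 ≤ (Ioc 0 r).indicator (fun y => ε ^ (-(2 * k)) * y ^ m) y +
        t.indicator (fun y => y ^ s) y) ∧
      (∀ y, 0 < y → y < 2 * R → y ^ m / (ε + y ^ α) ^ (2 * k) ≤
        (Ioc 0 r).indicator (fun y => ε ^ (-(2 * k)) * y ^ m) y +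
        t.indicator (fun y => y ^ s) y) := by
    intro ε r t hε hr htr hrt
    have h1 : ∀ y, 0 < y → 0 ≤ (Ioc 0 r).indicator (fun y => ε ^ (-(2 * k)) * y ^ m) y :=
      fun y hy => indicator_apply_nonneg fun _ => by positivity
    have h2 : ∀ y, 0 < y → 0 ≤ t.indicator (fun y => y ^ s) y :=
      fun y hy => indicator_apply_nonneg fun _ => by positivity
    refine ⟨fun y hy => add_nonneg (h1 y hy) (h2 y hy), fun y hy hyR => ?_⟩
    rcases le_or_gt y r with h | h
    · refine le_trans ?_ (le_add_of_nonneg_right (h2 y hy))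
      rw [indicator_of_mem (show y ∈ Ioc 0 r from ⟨hy, h⟩)]
      exact bubble_density_le_of_eps hε hy hk0.le
    · refine le_trans ?_ (le_add_of_nonneg_left (h1 y hy))
      rw [indicator_of_mem (hrt ⟨h, hyR⟩), hs]
      exact bubble_density_le_of_radius hε hy hk0.le
  have hinner : ∀ ε : ℝ, 0 < ε →
      ε ^ k * ∫ y in Ioc 0 (ε ^ (1 / α)), ε ^ (-(2 * k)) * y ^ m = ε ^ (2 / α) / (m + 1) := by
    intro ε hε
    rw [integral_const_mul, setIntegral_Ioc_rpow (by positivity) hm1, ← rpow_mul hε.le,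
      ← mul_assoc, ← rpow_add hε, ← mul_div_assoc, ← rpow_add hε]
    congr 2
    have : m + 1 = α * k + 2 := by rw [hαk, hm]; ring
    rw [this]; field_simp; ring
  have hscale : ∀ ε : ℝ, 0 < ε → ε ^ k * (ε ^ (1 / α)) ^ (s + 1) = ε ^ (2 / α) := by
    intro ε hε
    rw [← rpow_mul hε.le, ← rpow_add hε]
    congr 1
    have : s + 1 = 2 - α * k := by rw [hαk, hs']; ring
    rw [this]; field_simp; ring
  have hinner_int : ∀ ε r : ℝ, 0 < r →
      IntegrableOn (fun y => ε ^ (-(2 * k)) * y ^ m) (Ioc 0 r) := fun ε r hr =>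
    (integrableOn_Ioc_rpow hr.le hm1).const_mul _
  refine ⟨fun h => ?_, fun h => ?_, fun h => ?_⟩
  · have h4 : a < ((N : ℝ) - 4) / 2 := (lt_max_iff.1 h).resolve_left (not_lt.2 ha.le)
    have hs1 : s < -1 := by linarith
    refine key _ (1 / (m + 1) + -1 / (s + 1)) ?_
    filter_upwards [self_mem_nhdsWithin] with ε hε
    have hε : 0 < ε := hε
    have hr : 0 < ε ^ (1 / α) := by positivity
    obtain ⟨h0, hle⟩ := hglue ε (ε ^ (1 / α)) (Ioi (ε ^ (1 / α))) hε hr subset_rfl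
      Ioo_subset_Ioi_self
    obtain ⟨hi, hv⟩ := integrableOn_and_integral_glue measurableSet_Ioi hr.le subset_rfl
      (hinner_int ε _ hr) (integrableOn_Ioi_rpow_of_lt hs1 hr)
    refine ⟨_, h0, hi, hle, le_of_eq ?_⟩
    rw [hv, mul_add, hinner ε hε, integral_Ioi_rpow_of_lt hs1 hr,
      norm_of_nonneg (by positivity), ← hscale ε hε]
    ring
  · have hs1 : s = -1 := by linarith
    refine key _ (1 / (m + 1) + |log (2 * R)| + 1 / α) ?_
    have hlim : Tendsto (fun ε : ℝ => ε ^ (1 / α)) (nhdsWithin 0 (Ioi 0)) (nhds 0) := by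
      have := (continuousAt_rpow_const 0 (1 / α) (Or.inr (by positivity))).tendsto
      rw [zero_rpow (by positivity)] at this
      exact this.mono_left nhdsWithin_le_nhds
    filter_upwards [self_mem_nhdsWithin,
      hlim.eventually (gt_mem_nhds (show 0 < 2 * R by positivity)),
      nhdsWithin_le_nhds (gt_mem_nhds (exp_pos (-1)))] with ε hε hεR hεe
    have hε : 0 < ε := hε
    have hr : 0 < ε ^ (1 / α) := by positivity
    have hlog : log ε ≤ -1 := by
      rw [← log_exp (-1)]; exact log_le_log hε (le_of_lt hεe)
    obtain ⟨h0, hle⟩ := hglue ε (ε ^ (1 / α)) (Ioc (ε ^ (1 / α)) (2 * R)) hε hr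
      Ioc_subset_Ioi_self Ioo_subset_Ioc_self
    have hout : IntegrableOn (fun y : ℝ => y ^ s) (Ioc (ε ^ (1 / α)) (2 * R)) :=
      (intervalIntegrable_iff_integrableOn_Ioc_of_le hεR.le).1
        (intervalIntegral.intervalIntegrable_rpow (Or.inr (notMem_uIcc_of_lt hr (by positivity))))
    obtain ⟨hi, hv⟩ := integrableOn_and_integral_glue measurableSet_Ioc hr.le
      Ioc_subset_Ioi_self (hinner_int ε _ hr) hout
    refine ⟨_, h0, hi, hle, ?_⟩
    have hval : ∫ y in Ioc (ε ^ (1 / α)) (2 * R), y ^ s = log (2 * R) - 1 / α * log ε := by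
      rw [← intervalIntegral.integral_of_le hεR.le, hs1]
      simp_rw [rpow_neg_one]
      rw [integral_inv_of_pos hr (by positivity), log_div (by positivity) hr.ne', log_rpow hε]
    have hsc : ε ^ k = ε ^ (2 / α) := by
      rw [← hscale ε hε, hs1]; simp
    rw [hv, mul_add, hinner ε hε, hval, hsc, norm_of_nonneg (by positivity),
      abs_of_nonpos (by linarith : log ε ≤ 0)]
    have hb1 : 1 / (m + 1) ≤ 1 / (m + 1) * -log ε :=
      le_mul_of_one_le_right (one_div_nonneg.2 (by linarith)) (by linarith)
    have hb2 : log (2 * R) ≤ |log (2 * R)| * -log ε :=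
      (le_abs_self _).trans (le_mul_of_one_le_right (abs_nonneg _) (by linarith))
    calc ε ^ (2 / α) / (m + 1) + ε ^ (2 / α) * (log (2 * R) - 1 / α * log ε)
        = ε ^ (2 / α) * (1 / (m + 1) + log (2 * R) + 1 / α * -log ε) := by ring
      _ ≤ ε ^ (2 / α) * (1 / (m + 1) * -log ε + |log (2 * R)| * -log ε + 1 / α * -log ε) := by
          gcongr
      _ = _ := by ring
  · have hs1 : -1 < s := by
      have := (max_lt_iff.1 h).2
      linarith
    have h2R : 0 ≤ 2 * R := by positivity
    refine key _ (∫ y in Ioi (0 : ℝ), (Ioc 0 (2 * R)).indicator (fun y => y ^ s) y) ?_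
    filter_upwards [self_mem_nhdsWithin] with ε hε
    have hε : 0 < ε := hε
    refine ⟨(Ioc 0 (2 * R)).indicator (fun y => y ^ s), fun y hy =>
      indicator_apply_nonneg fun _ => by positivity,
      ((integrableOn_Ioc_rpow h2R hs1).integrable_indicator measurableSet_Ioc).integrableOn,
      fun y hy hyR => ?_, ?_⟩
    · rw [indicator_of_mem (show y ∈ Ioc 0 (2 * R) from ⟨hy, hyR.le⟩), hs]
      exact bubble_density_le_of_radius hε hy hk0.le
    · rw [norm_of_nonneg (by positivity), mul_comm]
end
end
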